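/- Let G be a unicyclic graph whose cycle is a triangle u ~ v ~ w ~ u, such that the trees (possibly empty) attached to u, v and w are paths, and assume deg(u) ≥ deg(v) ≥ deg(w). Write N(u) = {v, w} ∪ {u₁,…,u_n} and N(v) = {w, u} ∪ {v₁,…,v_m} with m ≥ 1. Let G* be the graph obtained from G by deleting the edges v v_i and adding the edges u v_i for all 1 ≤ i ≤ m. Then SO(G*) > SO(G). -/

import Mathlib

open SimpleGraph

/-- The Sombor index of a finite simple graph:
`SO(G) = Σ_{uv ∈ E(G)} √(d(u)² + d(v)²)`. -/
noncomputable def somborIndex {V : Type*} [Fintype V] (G : SimpleGraph V) : ℝ :=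
  letI := Classical.decEq V
  letI : DecidableRel G.Adj := Classical.decRel _
  ∑ e ∈ G.edgeFinset,
    Sym2.lift ⟨fun a b => Real.sqrt ((G.degree a : ℝ) ^ 2 + (G.degree b : ℝ) ^ 2),
      fun a b => by simp [add_comm]⟩ e

/-- A unicyclic graph: a connected graph whose number of edges equals its
number of vertices (equivalently, a connected graph with exactly one cycle). -/
def Unicyclic {V : Type*} [Fintype V] (G : SimpleGraph V) : Prop :=
  letI := Classical.decEq V
  letI : DecidableRel G.Adj := Classical.decRel _
  G.Connected ∧ G.edgeFinset.card = Fintype.card V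

/-- The edge weight for a real-valued vertex function. -/
noncomputable def sombWt {V : Type*} (d : V → ℝ) (e : Sym2 V) : ℝ :=
  Sym2.lift ⟨fun a b => Real.sqrt (d a ^ 2 + d b ^ 2), fun a b => by simp [add_comm]⟩ e

theorem sombWt_mk {V : Type*} (d : V → ℝ) (a b : V) :
    sombWt d s(a, b) = Real.sqrt (d a ^ 2 + d b ^ 2) := rfl

theorem somborIndex_eq {V : Type*} [Fintype V] [DecidableEq V] (G : SimpleGraph V)
    [DecidableRel G.Adj] :
    somborIndex G = ∑ e ∈ G.edgeFinset, sombWt (fun t => (G.degree t : ℝ)) e := by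
  unfold somborIndex sombWt
  convert rfl

theorem le_of_sq_le_aux (a b : ℝ) (h : a ^ 2 ≤ b ^ 2) (hb : 0 ≤ b) : a ≤ b :=
  (le_abs_self a).trans (abs_le_of_sq_le_sq h hb)

theorem sombor_convex (n m c : ℝ) (hn : 0 ≤ n) (hm : 0 < m) :
    Real.sqrt ((n + 2) ^ 2 + c ^ 2) + Real.sqrt ((m + 2) ^ 2 + c ^ 2) ≤
      Real.sqrt ((n + m + 2) ^ 2 + c ^ 2) + Real.sqrt (2 ^ 2 + c ^ 2) := by
  set A := Real.sqrt (2 ^ 2 + c ^ 2) with hA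
  set D := Real.sqrt ((n + m + 2) ^ 2 + c ^ 2) with hD
  have hA0 : 0 ≤ A := Real.sqrt_nonneg _
  have hD0 : 0 ≤ D := Real.sqrt_nonneg _
  have hA2 : A ^ 2 = 2 ^ 2 + c ^ 2 := Real.sq_sqrt (by positivity)
  have hD2 : D ^ 2 = (n + m + 2) ^ 2 + c ^ 2 := Real.sq_sqrt (by positivity)
  have hAD : 2 * (n + m + 2) + c ^ 2 ≤ A * D := by
    refine le_of_sq_le_aux _ _ ?_ (by positivity)
    rw [mul_pow, hA2, hD2]
    nlinarith [mul_nonneg (sq_nonneg c) (sq_nonneg (n + m))]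
  have hS : 0 < n + m := by linarith
  have key : ∀ p q : ℝ, 0 ≤ p → 0 ≤ q → p + q = n + m →
      (n + m) * Real.sqrt ((p + 2) ^ 2 + c ^ 2) ≤ q * A + p * D := by
    intro p q hp hq hpq
    refine le_of_sq_le_aux _ _ ?_ (by positivity)
    rw [mul_pow, Real.sq_sqrt (by positivity)]
    have e : (q * A + p * D) ^ 2 = q ^ 2 * A ^ 2 + p ^ 2 * D ^ 2 + 2 * (p * q) * (A * D) := by ring
    rw [e, hA2, hD2]
    have := mul_le_mul_of_nonneg_left hAD (by positivity : 0 ≤ 2 * (p * q))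
    rw [← hpq] at this ⊢
    nlinarith [this]
  have k1 := key n m hn hm.le rfl
  have k2 := key m n hm.le hn (add_comm _ _)
  refine le_of_mul_le_mul_left ?_ hS
  nlinarith

theorem le_deg {V : Type*} [Fintype V] [DecidableEq V] (G : SimpleGraph V) [DecidableRel G.Adj]
    (t : V) (s : Finset V) (h : ∀ x ∈ s, G.Adj t x) : s.card ≤ G.degree t := by
  rw [← G.card_neighborFinset_eq_degree]
  exact Finset.card_le_card fun x hx => by simpa using h x hx

theorem no_common {V : Type*} [Fintype V] (G : SimpleGraph V) (hG : Unicyclic G)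
    (u v w x : V) (huv : G.Adj u v) (hvw : G.Adj v w) (hwu : G.Adj w u)
    (hvx : G.Adj v x) (hux : G.Adj u x) : x = w := by
  classical
  by_contra hne
  obtain ⟨hc, hcard⟩ := hG
  set S : Set (Sym2 V) := {s(u, x), s(u, w)} with hS
  have hv : ∀ z, z ≠ v → s(v, z) ≠ s(u, x) ∧ s(v, z) ≠ s(u, w) := by
    have := huv.ne; have := hvx.ne; have := hvw.ne
    intro z hz
    simp only [ne_eq, Sym2.eq_iff]
    grind
  have av : ∀ z, G.Adj v z → (G.deleteEdges S).Adj v z := by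
    intro z hz
    rw [SimpleGraph.deleteEdges_adj]
    refine ⟨hz, ?_⟩
    have := hv z hz.ne'
    simp [hS, this]
  have r : ∀ a b, G.Adj a b → (G.deleteEdges S).Reachable a b := by
    intro a b hab
    by_cases h : s(a, b) ∈ S
    · have ru := (av u huv.symm).reachable
      have rx := (av x hvx).reachable
      have rw' := (av w hvw).reachable
      simp only [hS, Set.mem_insert_iff, Set.mem_singleton_iff, Sym2.eq_iff] at h
      rcases h with (⟨rfl, rfl⟩ | ⟨rfl, rfl⟩) | (⟨rfl, rfl⟩ | ⟨rfl, rfl⟩)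
      · exact ru.symm.trans rx
      · exact rx.symm.trans ru
      · exact ru.symm.trans rw'
      · exact rw'.symm.trans ru
    · exact (SimpleGraph.deleteEdges_adj.2 ⟨hab, h⟩ : (G.deleteEdges S).Adj a b).reachable
  have hc' : (G.deleteEdges S).Connected := by
    have := hc.nonempty
    refine ⟨fun a b => ?_⟩
    obtain ⟨p⟩ := hc.preconnected a b
    induction p with
    | nil => exact SimpleGraph.Reachable.refl _
    | cons h _ ih => exact (r _ _ h).trans ih
  have h1 := hc'.card_vert_le_card_edgeSet_add_one
  rw [SimpleGraph.edgeSet_deleteEdges] at h1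
  have hsub : S ⊆ G.edgeSet := by
    intro e he
    rcases he with rfl | rfl
    · exact hux
    · exact hwu.symm
  have h2 : S.ncard = 2 := Set.ncard_pair (by
    have := huv.ne; have := hux.ne
    simp only [ne_eq, Sym2.eq_iff]
    grind)
  have h3 := Set.ncard_sdiff_add_ncard_of_subset hsub
  have h4 : G.edgeSet.ncard = Fintype.card V := by
    rw [← hcard, ← Set.ncard_coe_finset]
    congr 1
    simp
  rw [Nat.card_coe_set_eq, Nat.card_eq_fintype_card] at h1
  omega

/-- Lemma 3.8: the cycle of the unicyclic graph `G` is the triangle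
`u ~ v ~ w ~ u`, all attached trees are paths (every vertex off the triangle
has degree `≤ 2`), and `deg u ≥ deg v ≥ deg w`.  Moving all the branches
`v₁, …, v_m` of `v` over to `u` strictly increases the Sombor index. -/
theorem sombor_triangle_shift {V : Type*} [Fintype V]
    (G : SimpleGraph V) [DecidableRel G.Adj] (hG : Unicyclic G)
    (u v w : V) (huv : G.Adj u v) (hvw : G.Adj v w) (hwu : G.Adj w u)
    (hpaths : ∀ t : V, t ∉ ({u, v, w} : Set V) → G.degree t ≤ 2)
    (hdvu : G.degree v ≤ G.degree u) (hdwv : G.degree w ≤ G.degree v)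
    (n m : ℕ) (hm : 1 ≤ m)
    (U : Fin n → V) (hUinj : Function.Injective U)
    (hU : G.neighborSet u = {v, w} ∪ Set.range U) (hdu : G.degree u = n + 2)
    (W : Fin m → V) (hWinj : Function.Injective W)
    (hW : G.neighborSet v = {w, u} ∪ Set.range W) (hdv : G.degree v = m + 2)
    (G' : SimpleGraph V)
    (hG' : G'.edgeSet =
      (G.edgeSet \ {e | ∃ i : Fin m, e = s(v, W i)}) ∪
        {e | ∃ i : Fin m, e = s(u, W i)}) :
    somborIndex G < somborIndex G' := by
  classical
  have nuv := huv.ne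
  have nvw := hvw.ne
  have nwu := hwu.ne
  have hWadj : ∀ i, G.Adj v (W i) := fun i => by
    have : W i ∈ G.neighborSet v := by rw [hW]; right; exact ⟨i, rfl⟩
    exact this
  have hWmem : ∀ x, G.Adj v x → x = w ∨ x = u ∨ ∃ i, W i = x := fun x hx => by
    have : x ∈ G.neighborSet v := hx
    rw [hW] at this
    simpa [or_assoc] using this
  -- the degree of v forces W to avoid w and u
  have hcardv : m + 2 ≤ (insert w (insert u (Finset.univ.image W))).card := by
    rw [← hdv, ← G.card_neighborFinset_eq_degree]
    apply Finset.card_le_card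
    intro x hx
    have := hWmem x (by simpa using hx)
    simpa using this
  have hcW : (Finset.univ.image W).card = m := by
    rw [Finset.card_image_of_injective _ hWinj]; simp
  have hWu : ∀ i, W i ≠ u := by
    intro i hi
    have : u ∈ Finset.univ.image W := by simp only [Finset.mem_image]; exact ⟨i, by simp, hi⟩
    rw [Finset.insert_eq_of_mem this] at hcardv
    have := Finset.card_insert_le w (Finset.univ.image W)
    omega
  have hWw : ∀ i, W i ≠ w := by
    intro i hi
    have : w ∈ insert u (Finset.univ.image W) := by
      simp only [Finset.mem_insert, Finset.mem_image]; exact Or.inr ⟨i, by simp, hi⟩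
    rw [Finset.insert_eq_of_mem this] at hcardv
    have := Finset.card_insert_le u (Finset.univ.image W)
    omega
  have hWv : ∀ i, W i ≠ v := fun i => (hWadj i).ne'
  have hWnu : ∀ i, ¬ G.Adj u (W i) := fun i h =>
    hWw i (no_common G hG u v w (W i) huv hvw hwu (hWadj i) h)
  have hadj' : ∀ a b, G'.Adj a b ↔ (G.Adj a b ∧ ∀ i, s(a, b) ≠ s(v, W i)) ∨
      ∃ i, s(a, b) = s(u, W i) := by
    intro a b
    rw [← SimpleGraph.mem_edgeSet, hG']
    simp
  -- degrees
  have du : n + m + 2 ≤ G'.degree u := by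
    have := le_deg G' u (G.neighborFinset u ∪ Finset.univ.image W) (by
      intro x hx
      rw [hadj']
      rcases Finset.mem_union.1 hx with hx | hx
      · left
        have hx : G.Adj u x := by simpa using hx
        refine ⟨hx, fun i h => ?_⟩
        rw [Sym2.eq_iff] at h
        rcases h with ⟨h, _⟩ | ⟨h, _⟩
        · exact nuv h
        · exact hWu i h.symm
      · right
        obtain ⟨i, _, rfl⟩ := Finset.mem_image.1 hx
        exact ⟨i, rfl⟩)
    rw [Finset.card_union_of_disjoint, hcW, G.card_neighborFinset_eq_degree, hdu] at this
    · omega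
    · rw [Finset.disjoint_right]
      intro x hx
      obtain ⟨i, _, rfl⟩ := Finset.mem_image.1 hx
      simpa using hWnu i
  have dv : 2 ≤ G'.degree v := by
    have := le_deg G' v {u, w} (by
      intro x hx
      rw [hadj']
      left
      simp only [Finset.mem_insert, Finset.mem_singleton] at hx
      rcases hx with rfl | rfl
      · refine ⟨huv.symm, fun i h => ?_⟩
        rw [Sym2.eq_iff] at h
        have := hWu i; have := hWv i
        grind
      · refine ⟨hvw, fun i h => ?_⟩
        rw [Sym2.eq_iff] at h
        have := hWw i; have := hWv i
        grind)
    rwa [Finset.card_pair nwu.symm] at this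
  have dt : ∀ t, t ≠ v → G.degree t ≤ G'.degree t := by
    intro t ht
    by_cases htW : ∃ i, W i = t
    · obtain ⟨i, rfl⟩ := htW
      have := le_deg G' (W i) (insert u ((G.neighborFinset (W i)).erase v)) (by
        intro x hx
        rw [hadj']
        simp only [Finset.mem_insert, Finset.mem_erase, SimpleGraph.mem_neighborFinset] at hx
        rcases hx with rfl | ⟨h1, h2⟩
        · right; exact ⟨i, Sym2.eq_swap⟩
        · left
          refine ⟨h2, fun j h => ?_⟩
          rw [Sym2.eq_iff] at h
          grind)
      rw [Finset.card_insert_of_notMem, Finset.card_erase_of_mem,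
        G.card_neighborFinset_eq_degree] at this
      · omega
      · simpa using (hWadj i).symm
      · simp only [Finset.mem_erase, SimpleGraph.mem_neighborFinset]
        exact fun h => hWnu i h.2.symm
    · have := le_deg G' t (G.neighborFinset t) (by
        intro x hx
        rw [hadj']
        left
        refine ⟨by simpa using hx, fun j h => ?_⟩
        rw [Sym2.eq_iff] at h
        grind)
      rwa [G.card_neighborFinset_eq_degree] at this
  -- real versions
  rw [somborIndex_eq G, somborIndex_eq G']
  set d : V → ℝ := fun t => (G.degree t : ℝ) with hd
  set d' : V → ℝ := fun t => (G'.degree t : ℝ) with hd'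
  have d0 : ∀ t, 0 ≤ d t := fun t => Nat.cast_nonneg _
  have d0' : ∀ t, 0 ≤ d' t := fun t => Nat.cast_nonneg _
  have rdu : d u = n + 2 := by simp [hd, hdu]
  have rdv : d v = m + 2 := by simp [hd, hdv]
  have rdu' : (n : ℝ) + m + 2 ≤ d' u := by simp only [hd']; exact_mod_cast du
  have rdv' : (2 : ℝ) ≤ d' v := by simp only [hd']; exact_mod_cast dv
  have rdt : ∀ t, t ≠ v → d t ≤ d' t := fun t ht => by
    simp only [hd, hd']; exact_mod_cast dt t ht
  have hn0 : (0 : ℝ) ≤ n := Nat.cast_nonneg _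
  have hm0 : (1 : ℝ) ≤ m := by exact_mod_cast hm
  have hnm : (m : ℝ) ≤ n := by
    have : m ≤ n := by omega
    exact_mod_cast this
  have mono : ∀ a b a' b' : ℝ, 0 ≤ a → 0 ≤ b → a ≤ a' → b ≤ b' →
      Real.sqrt (a ^ 2 + b ^ 2) ≤ Real.sqrt (a' ^ 2 + b' ^ 2) := by
    intro a b a' b' ha hb h1 h2
    apply Real.sqrt_le_sqrt
    gcongr
  -- edge decomposition
  set A : Finset (Sym2 V) := Finset.univ.image (fun i => s(v, W i)) with hA
  set B : Finset (Sym2 V) := Finset.univ.image (fun i => s(u, W i)) with hB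
  set P : Finset (Sym2 V) := {s(u, w), s(v, w)} with hP
  set R : Finset (Sym2 V) := (G.edgeFinset \ A) \ P with hR
  have hAsub : A ⊆ G.edgeFinset := by
    intro e he
    obtain ⟨i, _, rfl⟩ := Finset.mem_image.1 he
    simpa using hWadj i
  have hPsub : P ⊆ G.edgeFinset \ A := by
    intro e he
    simp only [hP, Finset.mem_insert, Finset.mem_singleton] at he
    simp only [Finset.mem_sdiff, hA, Finset.mem_image, Finset.mem_univ, true_and, not_exists]
    rcases he with rfl | rfl
    · refine ⟨by simpa using hwu.symm, fun i h => ?_⟩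
      rw [Sym2.eq_iff] at h
      grind
    · refine ⟨by simpa using hvw, fun i h => ?_⟩
      rw [Sym2.eq_iff] at h
      grind
  have hE' : G'.edgeFinset = (G.edgeFinset \ A) ∪ B := by
    ext e
    induction e using Sym2.ind with
    | _ a b =>
      simp only [SimpleGraph.mem_edgeFinset, SimpleGraph.mem_edgeSet, hadj', Finset.mem_union,
        Finset.mem_sdiff, hA, hB, Finset.mem_image, Finset.mem_univ, true_and, not_exists, ne_eq,
        eq_comm (a := s(a, b))]
  have hdisj : Disjoint (G.edgeFinset \ A) B := by
    rw [Finset.disjoint_right]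
    intro e he h
    obtain ⟨i, _, rfl⟩ := Finset.mem_image.1 he
    have h := (Finset.mem_sdiff.1 h).1
    exact hWnu i (by simpa using h)
  have injv : Function.Injective (fun i => s(v, W i)) := by
    intro i j h
    simp only [Sym2.eq_iff] at h
    apply hWinj
    grind
  have inju : Function.Injective (fun i => s(u, W i)) := by
    intro i j h
    simp only [Sym2.eq_iff] at h
    apply hWinj
    grind
  rw [hE', Finset.sum_union hdisj, ← Finset.sum_sdiff hAsub, ← Finset.sum_sdiff hPsub,
    ← Finset.sum_sdiff hPsub]
  have hRle : ∑ e ∈ R, sombWt d e ≤ ∑ e ∈ R, sombWt d' e := by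
    have uvle : sombWt d s(u, v) ≤ sombWt d' s(u, v) := by
      rw [sombWt_mk, sombWt_mk, rdu, rdv]
      refine le_trans (Real.sqrt_le_sqrt ?_)
        (mono (n + m + 2) 2 _ _ (by positivity) (by norm_num) rdu' rdv')
      nlinarith
    have vcase : ∀ b, s(v, b) ∈ R → b = u := by
      intro b hb
      simp only [hR, hP, hA, Finset.mem_sdiff, Finset.mem_insert, Finset.mem_singleton,
        SimpleGraph.mem_edgeFinset, SimpleGraph.mem_edgeSet, Finset.mem_image, Finset.mem_univ,
        true_and, not_exists, not_or] at hb
      rcases hWmem b hb.1.1 with rfl | h | ⟨i, rfl⟩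
      · exact absurd rfl hb.2.2
      · exact h
      · exact absurd rfl (hb.1.2 i)
    apply Finset.sum_le_sum
    intro e he
    induction e using Sym2.ind with
    | _ a b =>
      by_cases ha : a = v
      · subst ha
        rw [vcase b he, Sym2.eq_swap]
        exact uvle
      · by_cases hb : b = v
        · subst hb
          rw [vcase a (by rwa [Sym2.eq_swap])]
          exact uvle
        · exact mono _ _ _ _ (d0 a) (d0 b) (rdt a ha) (rdt b hb)
  have hPle : ∑ e ∈ P, sombWt d e ≤ ∑ e ∈ P, sombWt d' e := by
    have hne : s(u, w) ≠ s(v, w) := by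
      simp only [ne_eq, Sym2.eq_iff]
      grind
    rw [hP, Finset.sum_pair hne, Finset.sum_pair hne]
    simp only [sombWt_mk]
    rw [rdu, rdv]
    have hw := rdt w nvw.symm
    have := sombor_convex n m (d w) hn0 (by linarith)
    have h1 := mono (n + m + 2) (d w) _ _ (by positivity) (d0 w) rdu' hw
    have h2 := mono 2 (d w) _ _ (by norm_num) (d0 w) rdv' hw
    linarith
  have hABlt : ∑ e ∈ A, sombWt d e < ∑ e ∈ B, sombWt d' e := by
    rw [hA, hB, Finset.sum_image (fun i _ j _ h => injv h),
      Finset.sum_image (fun i _ j _ h => inju h)]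
    apply Finset.sum_lt_sum_of_nonempty
    · exact ⟨⟨0, hm⟩, Finset.mem_univ _⟩
    · intro i _
      rw [sombWt_mk, sombWt_mk, rdv]
      have hi := rdt (W i) (hWv i)
      refine lt_of_lt_of_le (Real.sqrt_lt_sqrt (by positivity) ?_)
        (mono (n + m + 2) (d (W i)) _ _ (by positivity) (d0 _) rdu' hi)
      nlinarith
  linarith
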